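/- The coincidence set of a superharmonic function and a strictly subharmonic C² function is Lebesgue-null (Proposition 6.6). Let U ⊆ ℝ^d be an open set. Let u₁ : U → ℝ be a locally integrable superharmonic function on U, and let u₂ : U → ℝ be twice continuously differentiable with Δu₂(x) > 0 for every x ∈ U. Then the set {x ∈ U : u₁(x) = u₂(x)} has Lebesgue measure zero. -/

import Mathlib

open MeasureTheory Metric Set

noncomputable def laplacian {d : ℕ} (f : EuclideanSpace ℝ (Fin d) → ℝ)
    (x : EuclideanSpace ℝ (Fin d)) : ℝ :=
  ∑ i : Fin d, iteratedFDeriv ℝ 2 f x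
    ![EuclideanSpace.single i (1:ℝ), EuclideanSpace.single i (1:ℝ)]

/-- A function is superharmonic on an open set `U` if it is lower semicontinuous on `U`
and satisfies the super-mean-value property on every closed ball contained in `U`. -/
def Superharmonic {d : ℕ} (U : Set (EuclideanSpace ℝ (Fin d)))
    (ψ : EuclideanSpace ℝ (Fin d) → ℝ) : Prop :=
  LowerSemicontinuousOn ψ U ∧
  ∀ x ∈ U, ∀ ρ : ℝ, 0 < ρ → closedBall x ρ ⊆ U →
    ⨍ y in closedBall x ρ, ψ y ≤ ψ x

open scoped Topology

section

variable {E : Type*} [NormedAddCommGroup E] [NormedSpace ℝ E]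

theorem ContDiffAt.exists_ball_taylor_two_lower_bound {u : E → ℝ} {x₀ : E}
    (hu : ContDiffAt ℝ 2 u x₀) {ε : ℝ} (hε : 0 < ε) :
    ∃ δ > 0, ∀ y ∈ ball x₀ δ, ∀ z ∈ ball x₀ δ,
      u y + fderiv ℝ u y (z - y) + fderiv ℝ (fderiv ℝ u) x₀ (z - y) (z - y) / 2
        - ε * ‖z - y‖ ^ 2 ≤ u z := by
  set A := fderiv ℝ (fderiv ℝ u) x₀ with hA
  have hsymm : ∀ a b, A a b = A b a :=
    hu.isSymmSndFDerivAt (by simp)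
  have hstrict : HasStrictFDerivAt (fderiv ℝ u) A x₀ :=
    (hu.fderiv_right (m := 1) (by norm_num)).hasStrictFDerivAt (by simp)
  have hdiff : ∀ᶠ z in 𝓝 x₀, DifferentiableAt ℝ u z := by
    filter_upwards [hu.eventually (by simp)] with z hz using hz.differentiableAt (by simp)
  have hlo := hstrict.isLittleO.def hε
  rw [nhds_prod_eq, Filter.eventually_prod_self_iff'] at hlo
  obtain ⟨t, ht, hlo⟩ := hlo
  obtain ⟨δ, hδ, hball⟩ := Metric.eventually_nhds_iff_ball.1 (hdiff.and ht)
  refine ⟨δ, hδ, fun y hy z hz => ?_⟩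
  have hseg : segment ℝ y z ⊆ ball x₀ δ := (convex_ball x₀ δ).segment_subset hy hz
  have hderiv : ∀ w ∈ segment ℝ y z, HasFDerivWithinAt
      (fun w => u w - fderiv ℝ u y (w - y) - A (w - y) (w - y) / 2)
      (fderiv ℝ u w - fderiv ℝ u y - A (w - y)) (segment ℝ y z) w := by
    intro w hw
    have hid : HasFDerivAt (fun w => w - y) (ContinuousLinearMap.id ℝ E) w :=
      (hasFDerivAt_id w).sub_const y
    have h1 := (hball w (hseg hw)).1.hasFDerivAt
    have h2 := (fderiv ℝ u y).hasFDerivAt.comp w hid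
    have h3 := ((A.hasFDerivAt.comp w hid).clm_apply hid).mul_const (1 / 2 : ℝ)
    refine (((h1.sub h2).sub h3).congr_fderiv ?_).hasFDerivWithinAt.congr_of_eventuallyEq ?_ ?_
    · ext a
      simp [hsymm a]
      ring
    · filter_upwards with w
      simp [div_eq_mul_inv]
    · simp [div_eq_mul_inv]
  have hbound : ∀ w ∈ segment ℝ y z, ‖fderiv ℝ u w - fderiv ℝ u y - A (w - y)‖ ≤ ε * ‖z - y‖ := by
    intro w hw
    refine (hlo w (hball w (hseg hw)).2 y (hball y hy).2).trans ?_
    gcongr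
    exact norm_sub_le_of_mem_segment hw
  have hmv := (convex_segment y z).norm_image_sub_le_of_norm_hasFDerivWithin_le hderiv hbound
    (left_mem_segment ℝ y z) (right_mem_segment ℝ y z)
  have := (abs_le.1 hmv).1
  simp only [sub_self, map_zero, zero_div, sub_zero] at this
  linarith

end

section

variable {d : ℕ}

local notation "𝔼" => EuclideanSpace ℝ (Fin d)

theorem setIntegral_closedBall_comp_isometry (e : 𝔼 ≃ₗᵢ[ℝ] 𝔼) (f : 𝔼 → ℝ) (r : ℝ) :
    ∫ h in closedBall (0 : 𝔼) r, f (e h) = ∫ h in closedBall (0 : 𝔼) r, f h := by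
  have := e.measurePreserving.setIntegral_preimage_emb
    e.toHomeomorph.measurableEmbedding f (closedBall (0 : 𝔼) r)
  rwa [e.preimage_closedBall, map_zero] at this

theorem setIntegral_closedBall_coord_mul_coord {i j : Fin d} (hij : i ≠ j) (r : ℝ) :
    ∫ h in closedBall (0 : 𝔼) r, h i * h j = 0 := by
  have := setIntegral_closedBall_comp_isometry (LinearIsometryEquiv.piLpCongrRight 2
    fun k : Fin d => if k = i then LinearIsometryEquiv.neg ℝ else .refl ℝ ℝ)
    (fun h => h i * h j) r
  simp [hij.symm, integral_neg] at this
  linarith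

theorem setIntegral_closedBall_coord_sq (i j : Fin d) (r : ℝ) :
    ∫ h in closedBall (0 : 𝔼) r, h i * h i = ∫ h in closedBall (0 : 𝔼) r, h j * h j := by
  have := setIntegral_closedBall_comp_isometry (LinearIsometryEquiv.piLpCongrLeft 2 ℝ ℝ
    (Equiv.swap i j)) (fun h => h i * h i) r
  simpa [Equiv.piCongrLeft'] using this.symm

theorem Continuous.integrableOn_closedBall {f : 𝔼 → ℝ} (hf : Continuous f) (x : 𝔼) (r : ℝ) :
    IntegrableOn f (closedBall x r) :=
  hf.continuousOn.integrableOn_compact (isCompact_closedBall x r)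

theorem card_mul_setIntegral_closedBall_bilin (A : 𝔼 →L[ℝ] 𝔼 →L[ℝ] ℝ) (r : ℝ) :
    d * ∫ h in closedBall (0 : 𝔼) r, A h h =
      (∑ i, A (EuclideanSpace.single i 1) (EuclideanSpace.single i 1)) *
        ∫ h in closedBall (0 : 𝔼) r, ‖h‖ ^ 2 := by
  have hexp (h : 𝔼) : A h h = ∑ i, ∑ j,
      A (EuclideanSpace.single i 1) (EuclideanSpace.single j 1) * (h i * h j) := by
    have hh : h = ∑ i, h i • EuclideanSpace.single i (1 : ℝ) := by
      simpa using ((EuclideanSpace.basisFun (Fin d) ℝ).sum_repr h).symm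
    conv_lhs => rw [hh]
    simp only [map_sum, map_smul, sum_apply, smul_apply,
      smul_eq_mul, Finset.mul_sum]
    rw [Finset.sum_comm]
    exact Finset.sum_congr rfl fun i _ => Finset.sum_congr rfl fun j _ => by ring
  have hint (i j : Fin d) : IntegrableOn (fun h : 𝔼 => h i * h j) (closedBall 0 r) :=
    Continuous.integrableOn_closedBall (by fun_prop) _ _
  have hA : ∫ h in closedBall (0 : 𝔼) r, A h h =
      ∑ i, A (EuclideanSpace.single i 1) (EuclideanSpace.single i 1) *
        ∫ h in closedBall (0 : 𝔼) r, h i * h i := by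
    rw [integral_congr_ae (ae_of_all _ hexp),
      integral_finsetSum _ fun i _ => integrable_finsetSum _ fun j _ => (hint i j).const_mul _]
    refine Finset.sum_congr rfl fun i _ => ?_
    rw [integral_finsetSum _ fun j _ => (hint i j).const_mul _, Finset.sum_eq_single i]
    · rw [integral_const_mul]
    · intro j _ hj
      rw [integral_const_mul, setIntegral_closedBall_coord_mul_coord hj.symm, mul_zero]
    · simp
  have hN : ∫ h in closedBall (0 : 𝔼) r, ‖h‖ ^ 2 =
      ∑ i, ∫ h in closedBall (0 : 𝔼) r, h i * h i := by
    rw [← integral_finsetSum _ fun i _ => hint i i]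
    simp_rw [EuclideanSpace.norm_sq_eq, Real.norm_eq_abs, sq_abs, sq]
  rw [hA, hN, Finset.mul_sum, Finset.sum_mul]
  refine Finset.sum_congr rfl fun i _ => ?_
  rw [Finset.sum_congr rfl fun j _ => setIntegral_closedBall_coord_sq j i r]
  rw [Finset.sum_const, Finset.card_univ, Fintype.card_fin, nsmul_eq_mul]
  ring

theorem volume_real_closedBall_eq (x : 𝔼) {r : ℝ} (hr : 0 ≤ r) :
    volume.real (closedBall x r) = r ^ d * volume.real (ball (0 : 𝔼) 1) := by
  rw [Measure.addHaar_real_closedBall _ _ hr, finrank_euclideanSpace_fin]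

theorem sq_div_eight_mul_volume_le (hd : d ≠ 0) {r : ℝ} (hr : 0 ≤ r) :
    r ^ 2 / 8 * volume.real (closedBall (0 : 𝔼) r) ≤ ∫ h in closedBall (0 : 𝔼) r, ‖h‖ ^ 2 := by
  have hsub : closedBall (0 : 𝔼) (r / 2) ⊆ closedBall 0 r := closedBall_subset_closedBall (by linarith)
  have hint : IntegrableOn (fun h : 𝔼 => ‖h‖ ^ 2) (closedBall 0 r) :=
    Continuous.integrableOn_closedBall (by fun_prop) _ _
  have hfin : volume (closedBall (0 : 𝔼) r \ closedBall 0 (r / 2)) ≠ ⊤ :=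
    measure_ne_top_of_subset sdiff_subset measure_closedBall_lt_top.ne
  have h1 : (r / 2) ^ 2 * volume.real (closedBall (0 : 𝔼) r \ closedBall 0 (r / 2)) ≤
      ∫ h in closedBall (0 : 𝔼) r, ‖h‖ ^ 2 := by
    refine le_trans ?_ (setIntegral_mono_set hint (Filter.Eventually.of_forall fun h => by positivity)
      (sdiff_subset (t := closedBall (0 : 𝔼) (r / 2))).eventuallyLE)
    refine setIntegral_ge_of_const_le_real (measurableSet_closedBall.diff measurableSet_closedBall) hfin
      (fun h hh => ?_) (hint.mono_set sdiff_subset)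
    have : r / 2 < ‖h‖ := by simpa using hh.2
    gcongr
  rw [measureReal_sdiff hsub measurableSet_closedBall measure_closedBall_lt_top.ne] at h1
  have h2 : volume.real (closedBall (0 : 𝔼) (r / 2)) ≤ volume.real (closedBall (0 : 𝔼) r) / 2 := by
    rw [volume_real_closedBall_eq _ hr, volume_real_closedBall_eq _ (by positivity), div_pow]
    have : (2 : ℝ) ≤ 2 ^ d := le_self_pow₀ (by norm_num) hd
    rw [mul_div_right_comm]
    gcongr
  nlinarith [sq_nonneg r]


theorem setIntegral_closedBall_clm (L : 𝔼 →L[ℝ] ℝ) (r : ℝ) :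
    ∫ h in closedBall (0 : 𝔼) r, L h = 0 := by
  have := setIntegral_closedBall_comp_isometry (LinearIsometryEquiv.neg ℝ) L r
  simp [integral_neg] at this
  linarith

theorem setIntegral_closedBall_eq_comp_add (f : 𝔼 → ℝ) (y : 𝔼) (r : ℝ) :
    ∫ z in closedBall y r, f z = ∫ h in closedBall (0 : 𝔼) r, f (y + h) := by
  have := (measurePreserving_add_left volume y).setIntegral_preimage_emb
    (measurableEmbedding_addLeft y) f (closedBall y r)
  simpa using this.symm

theorem exists_local_strict_submean {u : 𝔼 → ℝ} {x₀ : 𝔼} (hu : ContDiffAt ℝ 2 u x₀)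
    (hlap : 0 < laplacian u x₀) :
    ∃ c > 0, ∃ δ > 0, ∀ y, ∀ r ≥ 0, closedBall y r ⊆ ball x₀ δ →
      IntegrableOn u (closedBall y r) →
      (u y + c * r ^ 2) * volume.real (closedBall y r) ≤ ∫ z in closedBall y r, u z := by
  set A := fderiv ℝ (fderiv ℝ u) x₀ with hA
  set τ := laplacian u x₀ with hτ
  have hd : d ≠ 0 := by
    rintro rfl
    simp [laplacian] at hτ
    exact hlap.ne' hτ
  have hd' : (0 : ℝ) < d := by positivity
  have htr : ∑ i, A (EuclideanSpace.single i 1) (EuclideanSpace.single i 1) = τ := by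
    simp [hτ, laplacian, iteratedFDeriv_two_apply, hA]
  obtain ⟨δ, hδ, htaylor⟩ := hu.exists_ball_taylor_two_lower_bound (ε := τ / (4 * d)) (by positivity)
  refine ⟨τ / (32 * d), by positivity, δ, hδ, fun y r hr hsub hint => ?_⟩
  have hy : y ∈ ball x₀ δ := hsub (mem_closedBall_self hr)
  set V := volume.real (closedBall (0 : 𝔼) r) with hV
  have hVy : volume.real (closedBall y r) = V := by
    rw [hV, Measure.addHaar_real_closedBall_center]
  set N := ∫ h in closedBall (0 : 𝔼) r, ‖h‖ ^ 2
  have hNV : r ^ 2 / 8 * V ≤ N := sq_div_eight_mul_volume_le hd hr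
  have hquad : ∫ h in closedBall (0 : 𝔼) r, A h h = τ / d * N := by
    have := card_mul_setIntegral_closedBall_bilin A r
    rw [htr] at this
    field_simp
    linarith
  have i1 : IntegrableOn (fun _ : 𝔼 => u y) (closedBall 0 r) :=
    Continuous.integrableOn_closedBall (by fun_prop) _ _
  have i2 : IntegrableOn (fun h : 𝔼 => fderiv ℝ u y h) (closedBall 0 r) :=
    Continuous.integrableOn_closedBall (by fun_prop) _ _
  have i3 : IntegrableOn (fun h : 𝔼 => A h h / 2) (closedBall 0 r) :=
    Continuous.integrableOn_closedBall (by fun_prop) _ _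
  have i4 : IntegrableOn (fun h : 𝔼 => τ / (4 * d) * ‖h‖ ^ 2) (closedBall 0 r) :=
    Continuous.integrableOn_closedBall (by fun_prop) _ _
  have i5 : IntegrableOn (fun h : 𝔼 => u (y + h)) (closedBall 0 r) := by
    have := ((measurePreserving_add_left volume y).integrableOn_comp_preimage
      (measurableEmbedding_addLeft y)).2 hint
    simpa [Function.comp_def] using this
  have i12 : IntegrableOn (fun h : 𝔼 => u y + fderiv ℝ u y h) (closedBall 0 r) := i1.add i2
  have i123 : IntegrableOn (fun h : 𝔼 => u y + fderiv ℝ u y h + A h h / 2) (closedBall 0 r) :=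
    i12.add i3
  have hle : ∫ h in closedBall (0 : 𝔼) r,
      (u y + fderiv ℝ u y h + A h h / 2 - τ / (4 * d) * ‖h‖ ^ 2) ≤
      ∫ h in closedBall (0 : 𝔼) r, u (y + h) := by
    refine setIntegral_mono_on (i123.sub i4) i5 measurableSet_closedBall
      fun h hh => ?_
    have := htaylor y hy (y + h) (hsub (by simpa using hh))
    simpa using this
  rw [integral_sub i123 i4, integral_add i12 i3, integral_add i1 i2,
    setIntegral_closedBall_clm, integral_div, hquad, integral_const_mul, setIntegral_const,
    smul_eq_mul, ← setIntegral_closedBall_eq_comp_add] at hle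
  rw [hVy]
  refine le_trans ?_ hle
  have : τ / (4 * d) * (r ^ 2 / 8 * V) ≤ τ / (4 * d) * N := by gcongr
  have e1 : τ / d * N / 2 - τ / (4 * d) * N = τ / (4 * d) * N := by field_simp; ring
  have e2 : τ / (32 * d) * r ^ 2 * V = τ / (4 * d) * (r ^ 2 / 8 * V) := by field_simp; ring
  linarith

theorem setIntegral_max_zero_half_le {v : 𝔼 → ℝ} {S : Set 𝔼} (hS : ∀ z ∈ S, v z = 0) {x : 𝔼}
    {r : ℝ} (hr : 0 < r) (hint : IntegrableOn v (closedBall x r))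
    (hsub : ∀ y ∈ closedBall x (r / 2), v y * volume.real (closedBall y (r / 2)) ≤
      ∫ z in closedBall y (r / 2), v z) {η : ℝ}
    (hη : volume.real (closedBall x (r / 2) \ S) ≤ η * volume.real (closedBall x (r / 2))) :
    ∫ z in closedBall x (r / 2), max (v z) 0 ≤ η * ∫ z in closedBall x r, max (v z) 0 := by
  set I := ∫ z in closedBall x r, max (v z) 0
  have hI0 : 0 ≤ I := integral_nonneg fun z => le_max_right _ _
  set V := volume.real (closedBall x (r / 2)) with hV
  have hVpos : 0 < V :=
    ENNReal.toReal_pos (measure_closedBall_pos _ _ (by positivity)).ne' measure_closedBall_lt_top.ne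
  have hmax : IntegrableOn (fun z => max (v z) 0) (closedBall x r) := hint.pos_part
  have hsup : ∀ y ∈ closedBall x (r / 2), max (v y) 0 ≤ I / V := by
    intro y hy
    refine max_le ?_ (by positivity)
    have hyx : closedBall y (r / 2) ⊆ closedBall x r := by
      refine closedBall_subset_closedBall' ?_
      linarith [mem_closedBall.1 hy]
    rw [le_div_iff₀ hVpos, hV, Measure.addHaar_real_closedBall_center,
      ← Measure.addHaar_real_closedBall_center volume y]
    refine (hsub y hy).trans ?_
    refine (setIntegral_mono (hint.mono_set hyx) (hmax.mono_set hyx)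
      fun z => le_max_left _ _).trans ?_
    exact setIntegral_mono_set hmax (Filter.Eventually.of_forall fun z => le_max_right _ _)
      hyx.eventuallyLE
  rw [setIntegral_eq_of_subset_of_forall_sdiff_eq_zero measurableSet_closedBall
    (sdiff_subset (t := S)) fun z hz => ?_]
  · refine (Real.le_norm_self _).trans ((norm_setIntegral_le_of_norm_le_const (C := I / V)
      ((measure_mono sdiff_subset).trans_lt measure_closedBall_lt_top) fun z hz => ?_).trans ?_)
    · rw [Real.norm_of_nonneg (le_max_right _ _)]
      exact hsup z hz.1
    · calc I / V * volume.real (closedBall x (r / 2) \ S) ≤ I / V * (η * V) := by gcongr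
        _ = η * I := by field_simp
  · have : z ∈ S := by
      by_contra h
      exact hz.2 ⟨hz.1, h⟩
    simp [hS z this]

theorem volume_zero_set_eq_zero_of_local_strict_submean {U : Set 𝔼} (hU : IsOpen U) {v : 𝔼 → ℝ}
    (hv : AEStronglyMeasurable v (volume.restrict U))
    (hint : ∀ y r, closedBall y r ⊆ U → IntegrableOn v (closedBall y r))
    (hsub : ∀ x ∈ U, ∃ c > 0, ∃ δ > 0, ∀ y, ∀ r > 0, closedBall y r ⊆ ball x δ →
      closedBall y r ⊆ U →
      (v y + c * r ^ 2) * volume.real (closedBall y r) ≤ ∫ z in closedBall y r, v z) :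
    volume {x ∈ U | v x = 0} = 0 := by
  set S := {x ∈ U | v x = 0} with hS
  have hSnull : NullMeasurableSet S := by
    have h1 : AEStronglyMeasurable (U.indicator v) :=
      (aestronglyMeasurable_indicator_iff hU.measurableSet).2 hv
    have h2 : S = U ∩ {x | U.indicator v x = 0} := by
      ext x
      simp +contextual [hS]
    rw [h2]
    exact hU.measurableSet.nullMeasurableSet.inter
      (nullMeasurableSet_eq_fun h1.aemeasurable aemeasurable_const)
  have hdens := Besicovitch.ae_tendsto_measure_inter_div volume S
  rw [ae_restrict_iff'₀ hSnull] at hdens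
  refine measure_mono_null (fun x hx => ?_) hdens
  intro hlim
  replace hlim := hlim hx
  obtain ⟨c, hc, δ, hδ, hsub⟩ := hsub x hx.1
  obtain ⟨ρ, hρ, hρU⟩ := Metric.isOpen_iff.1 hU x hx.1
  set η : ℝ := (1 / 2) ^ (d + 3) with hη
  have hηpos : 0 < η := by positivity
  have hlim' := (ENNReal.tendsto_toReal ENNReal.one_ne_top).comp hlim
  obtain ⟨σ, hσ, hdist⟩ := Metric.tendsto_nhdsWithin_nhds.1 hlim' η hηpos
  obtain ⟨R, hR, hRm⟩ : ∃ R > 0, R < min δ (min ρ σ) := exists_between (by positivity)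
  obtain ⟨hRδ, hRρ, hRσ⟩ : R < δ ∧ R < ρ ∧ R < σ := by simpa using hRm
  have hVpos (r : ℝ) (hr : 0 < r) : 0 < volume.real (closedBall x r) :=
    ENNReal.toReal_pos (measure_closedBall_pos _ _ hr).ne' measure_closedBall_lt_top.ne
  have hfrac (r : ℝ) (hr : 0 < r) (hrR : r ≤ R) :
      volume.real (closedBall x r \ S) ≤ η * volume.real (closedBall x r) := by
    have h1 := hdist (x := r) hr (by rw [Real.dist_0_eq_abs, abs_of_pos hr]; linarith)
    simp only [Function.comp_apply, ENNReal.toReal_div, ENNReal.toReal_one, Real.dist_eq] at h1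
    have h2 := (abs_lt.1 h1).1
    have h3 := measureReal_inter_add_sdiff₀ (μ := volume) (s := closedBall x r) hSnull
      measure_closedBall_lt_top.ne
    have h4 : 1 - η < volume.real (S ∩ closedBall x r) / volume.real (closedBall x r) := by
      simp only [measureReal_def]
      linarith
    rw [lt_div_iff₀ (hVpos r hr), inter_comm] at h4
    linarith
  have hballU (y : 𝔼) (r : ℝ) (h : closedBall y r ⊆ closedBall x R) :
      closedBall y r ⊆ U ∧ closedBall y r ⊆ ball x δ :=
    ⟨(h.trans (closedBall_subset_ball hRρ)).trans hρU, h.trans (closedBall_subset_ball hRδ)⟩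
  set I : ℝ → ℝ := fun r => ∫ z in closedBall x r, max (v z) 0
  have hstep (r : ℝ) (hr : 0 < r) (hrR : r ≤ R) : I (r / 2) ≤ η * I r := by
    refine setIntegral_max_zero_half_le (S := S) (fun z hz => hz.2) hr
      (hint x r (hballU x r (closedBall_subset_closedBall hrR)).1) (fun y hy => ?_)
      (hfrac _ (by positivity) (by linarith))
    have hyR : closedBall y (r / 2) ⊆ closedBall x R :=
      closedBall_subset_closedBall' (by linarith [mem_closedBall.1 hy])
    refine le_trans ?_ (hsub y (r / 2) (by positivity) (hballU y _ hyR).2 (hballU y _ hyR).1)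
    gcongr
    have : 0 ≤ c * (r / 2) ^ 2 := by positivity
    linarith
  have hlower (r : ℝ) (hr : 0 < r) (hrR : r ≤ R) :
      c * r ^ 2 * (r ^ d * volume.real (ball (0 : 𝔼) 1)) ≤ I r := by
    have hr' := hballU x r (closedBall_subset_closedBall hrR)
    have h1 := hsub x r hr hr'.2 hr'.1
    rw [hx.2, zero_add, volume_real_closedBall_eq x hr.le] at h1
    exact h1.trans (setIntegral_mono (hint x r hr'.1) (hint x r hr'.1).pos_part
      fun z => le_max_left _ _)
  have hdecay (n : ℕ) : I (R / 2 ^ n) ≤ η ^ n * I R := by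
    induction n with
    | zero => simp
    | succ n ih =>
      have h1 := hstep (R / 2 ^ n) (by positivity)
        (div_le_self hR.le (one_le_pow₀ (by norm_num)))
      rw [pow_succ, ← div_div, pow_succ, mul_assoc, mul_comm η, ← mul_assoc, mul_comm _ η]
      exact h1.trans (by gcongr)
  set K := c * R ^ 2 * (R ^ d * volume.real (ball (0 : 𝔼) 1)) with hK
  have hKpos : 0 < K := by
    have : 0 < volume.real (ball (0 : 𝔼) 1) :=
      ENNReal.toReal_pos (measure_ball_pos _ _ one_pos).ne' measure_ball_lt_top.ne
    positivity
  have hgrow (n : ℕ) : K * 2 ^ n ≤ I R := by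
    have h1 := (hlower (R / 2 ^ n) (by positivity)
      (div_le_self hR.le (one_le_pow₀ (by norm_num)))).trans (hdecay n)
    have h2 : c * (R / 2 ^ n) ^ 2 * ((R / 2 ^ n) ^ d * volume.real (ball (0 : 𝔼) 1)) =
        η ^ n * (K * 2 ^ n) := by
      have hηn : η ^ n = 1 / (2 ^ n) ^ (d + 3) := by
        rw [hη, ← pow_mul, mul_comm, pow_mul, one_div_pow, one_div_pow]
      rw [hηn, hK, div_pow, div_pow]
      have hq : (2 : ℝ) ^ n ≠ 0 := by positivity
      generalize (2 : ℝ) ^ n = q at hq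
      field_simp
      ring
    rw [h2] at h1
    exact le_of_mul_le_mul_left h1 (by positivity)
  obtain ⟨n, hn⟩ := pow_unbounded_of_one_lt (I R / K) (one_lt_two (α := ℝ))
  rw [div_lt_iff₀ hKpos] at hn
  linarith [hgrow n]

end

/-- **The coincidence set of a superharmonic function and a strictly subharmonic `C²`
function is Lebesgue-null** (Proposition 6.6).  Let `U ⊆ ℝ^d` be open, `u₁` a locally
integrable superharmonic function on `U`, and `u₂` twice continuously differentiable on `U`
with `Δu₂ > 0` everywhere in `U`.  Then `{x ∈ U : u₁(x) = u₂(x)}` has Lebesgue measure zero. -/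
theorem coincidence_set_null {d : ℕ}
    (U : Set (EuclideanSpace ℝ (Fin d))) (hUopen : IsOpen U)
    (u₁ u₂ : EuclideanSpace ℝ (Fin d) → ℝ)
    (h1loc : LocallyIntegrableOn u₁ U) (h1sh : Superharmonic U u₁)
    (h2smooth : ContDiffOn ℝ 2 u₂ U) (h2lap : ∀ x ∈ U, 0 < laplacian u₂ x) :
    volume {x ∈ U | u₁ x = u₂ x} = 0 := by
  have h2cont : ContinuousOn u₂ U := h2smooth.continuousOn
  have hi1 (y : EuclideanSpace ℝ (Fin d)) (r : ℝ) (h : closedBall y r ⊆ U) :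
      IntegrableOn u₁ (closedBall y r) :=
    h1loc.integrableOn_compact_subset h (isCompact_closedBall y r)
  have hi2 (y : EuclideanSpace ℝ (Fin d)) (r : ℝ) (h : closedBall y r ⊆ U) :
      IntegrableOn u₂ (closedBall y r) :=
    (h2cont.mono h).integrableOn_compact (isCompact_closedBall y r)
  have key := volume_zero_set_eq_zero_of_local_strict_submean hUopen (v := fun x => u₂ x - u₁ x)
    ((h2cont.aestronglyMeasurable hUopen.measurableSet).sub h1loc.aestronglyMeasurable)
    (fun y r h => (hi2 y r h).sub (hi1 y r h)) fun x hx => ?_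
  · convert key using 4
    rw [sub_eq_zero, eq_comm]
  · obtain ⟨c, hc, δ, hδ, h2⟩ := exists_local_strict_submean
      (h2smooth.contDiffAt (hUopen.mem_nhds hx)) (h2lap x hx)
    refine ⟨c, hc, δ, hδ, fun y r hr hyδ hyU => ?_⟩
    have hV : 0 < volume.real (closedBall y r) :=
      ENNReal.toReal_pos (measure_closedBall_pos _ _ hr).ne' measure_closedBall_lt_top.ne
    have h1 := h1sh.2 y (hyU (mem_closedBall_self hr.le)) r hr hyU
    rw [setAverage_eq, smul_eq_mul, inv_mul_le_iff₀ hV] at h1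
    rw [integral_sub (hi2 y r hyU) (hi1 y r hyU)]
    linarith [h2 y r hr.le hyδ (hi2 y r hyU)]
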